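/- arXiv:cs/9911008 — 4 statements merged into one kernel-verified Lean document; each statement's English description precedes it below -/
import Mathlib

section
/- Let {A_{i,j} : 0 ≤ i ≤ m, 1 ≤ j ≤ l} be n×n complex matrices satisfying ∑_{i=0}^{m} ∑_{j=1}^{l} A_{i,j}† A_{i,j} = I, and let ρ be an n×n density matrix. Define the real 2n×2n matrices A′_{i,j} by A′_{i,j}[2i′−1, 2j′−1] = Re(A_{i,j}[i′,j′]), A′_{i,j}[2i′−1, 2j′] = Im(A_{i,j}[i′,j′]), A′_{i,j}[2i′, 2j′−1] = −Im(A_{i,j}[i′,j′]), A′_{i,j}[2i′, 2j′] = Re(A_{i,j}[i′,j′]), and the real 2n×2n matrix ρ′ by ρ′[2i′−1, 2j′−1] = (1/2)Re(ρ[i′,j′]), ρ′[2i′−1, 2j′] = (1/2)Im(ρ[i′,j′]), ρ′[2i′, 2j′−1] = −(1/2)Im(ρ[i′,j′]), ρ′[2i′, 2j′] = (1/2)Re(ρ[i′,j′]). Then: (a) ∑_{i=0}^{m} ∑_{j=1}^{l} (A′_{i,j})ᵀ A′_{i,j} = I (the 2n×2n identity); (b) ρ′ is a real density matrix (symmetric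 positive semidefinite with trace 1); and (c) for every k ≥ 1 and every sequence r₁, …, r_k ∈ {0,…,m}, tr(F′_{r_k} ∘ ⋯ ∘ F′_{r_1}(ρ′)) = tr(F_{r_k} ∘ ⋯ ∘ F_{r_1}(ρ)), where F_i(σ) = ∑_{j=1}^{l} A_{i,j} σ A_{i,j}† and F′_i(σ) = ∑_{j=1}^{l} A′_{i,j} σ (A′_{i,j})ᵀ. -/
open Matrix ComplexOrder

/-- The realification of an `n × n` complex matrix `B`: the real `2n × 2n`
matrix with rows/columns indexed by `Fin n × Fin 2`, where `(i', 0)` encodes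
row `2i' - 1` and `(i', 1)` encodes row `2i'`, and entries
`B'[2i'-1, 2j'-1] = Re B[i',j']`, `B'[2i'-1, 2j'] = Im B[i',j']`,
`B'[2i', 2j'-1] = -Im B[i',j']`, `B'[2i', 2j'] = Re B[i',j']`. -/
def realify {n : ℕ} (B : Matrix (Fin n) (Fin n) ℂ) :
    Matrix (Fin n × Fin 2) (Fin n × Fin 2) ℝ :=
  fun p q =>
    if p.2 = 0 then
      (if q.2 = 0 then (B p.1 q.1).re else (B p.1 q.1).im)
    else
      (if q.2 = 0 then -(B p.1 q.1).im else (B p.1 q.1).re)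

/-- `FcState A r σ k = F_{r k} ∘ ⋯ ∘ F_{r 1} (σ)` where
`F_i(τ) = ∑ j, A i j * τ * (A i j)ᴴ` (complex case). -/
noncomputable def FcState {n m l : ℕ}
    (A : Fin (m + 1) → Fin l → Matrix (Fin n) (Fin n) ℂ) (r : ℕ → Fin (m + 1))
    (σ : Matrix (Fin n) (Fin n) ℂ) : ℕ → Matrix (Fin n) (Fin n) ℂ
  | 0 => σ
  | t + 1 => ∑ j, A (r (t + 1)) j * FcState A r σ t * (A (r (t + 1)) j)ᴴ

/-- `FrState A' r σ k = F'_{r k} ∘ ⋯ ∘ F'_{r 1} (σ)` where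
`F'_i(τ) = ∑ j, A' i j * τ * (A' i j)ᵀ` (real case). -/
noncomputable def FrState {n m l : ℕ}
    (A' : Fin (m + 1) → Fin l → Matrix (Fin n × Fin 2) (Fin n × Fin 2) ℝ)
    (r : ℕ → Fin (m + 1)) (σ : Matrix (Fin n × Fin 2) (Fin n × Fin 2) ℝ) :
    ℕ → Matrix (Fin n × Fin 2) (Fin n × Fin 2) ℝ
  | 0 => σ
  | t + 1 => ∑ j, A' (r (t + 1)) j * FrState A' r σ t * (A' (r (t + 1)) j)ᵀ

theorem realify_mul {n : ℕ} (B C : Matrix (Fin n) (Fin n) ℂ) :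
    realify (B * C) = realify B * realify C := by
  ext ⟨i, a⟩ ⟨j, b⟩
  fin_cases a <;> fin_cases b <;>
    simp [realify, mul_apply, Fintype.sum_prod_type, Finset.sum_add_distrib] <;>
    ring

theorem realify_conjTranspose {n : ℕ} (B : Matrix (Fin n) (Fin n) ℂ) :
    realify Bᴴ = (realify B)ᵀ := by
  ext ⟨i, a⟩ ⟨j, b⟩
  fin_cases a <;> fin_cases b <;> simp [realify]

theorem realify_sum {n : ℕ} {ι : Type*} (s : Finset ι)
    (f : ι → Matrix (Fin n) (Fin n) ℂ) :
    realify (∑ i ∈ s, f i) = ∑ i ∈ s, realify (f i) := by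
  ext ⟨i, a⟩ ⟨j, b⟩
  fin_cases a <;> fin_cases b <;> simp [realify, Matrix.sum_apply]

theorem realify_one {n : ℕ} : realify (1 : Matrix (Fin n) (Fin n) ℂ) = 1 := by
  ext ⟨i, a⟩ ⟨j, b⟩
  by_cases h : i = j <;> fin_cases a <;> fin_cases b <;> simp [realify, one_apply, h]

theorem trace_realify {n : ℕ} (B : Matrix (Fin n) (Fin n) ℂ) :
    (realify B).trace = 2 * B.trace.re := by
  simp [realify, trace, Fintype.sum_prod_type, Finset.mul_sum, two_mul]

open scoped MatrixOrder in
theorem realify_posSemidef {n : ℕ} {B : Matrix (Fin n) (Fin n) ℂ} (hB : B.PosSemidef) :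
    (realify B).PosSemidef := by
  obtain ⟨C, rfl⟩ := CStarAlgebra.nonneg_iff_eq_star_mul_self.mp hB.nonneg
  rw [star_eq_conjTranspose, realify_mul, realify_conjTranspose, ← conjTranspose_eq_transpose_of_trivial]
  exact posSemidef_conjTranspose_mul_self _

theorem FcState_posSemidef {n m l : ℕ}
    (A : Fin (m + 1) → Fin l → Matrix (Fin n) (Fin n) ℂ) (r : ℕ → Fin (m + 1))
    {σ : Matrix (Fin n) (Fin n) ℂ} (hσ : σ.PosSemidef) (k : ℕ) :
    (FcState A r σ k).PosSemidef := by
  induction k with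
  | zero => exact hσ
  | succ k ih => exact posSemidef_sum _ fun j _ => ih.mul_mul_conjTranspose_same _

theorem FrState_smul_realify {n m l : ℕ}
    (A : Fin (m + 1) → Fin l → Matrix (Fin n) (Fin n) ℂ) (r : ℕ → Fin (m + 1))
    (c : ℝ) (σ : Matrix (Fin n) (Fin n) ℂ) (k : ℕ) :
    FrState (fun i j => realify (A i j)) r (c • realify σ) k =
      c • realify (FcState A r σ k) := by
  induction k with
  | zero => rfl
  | succ k ih =>
    simp only [FrState, FcState, ih, realify_sum, realify_mul, realify_conjTranspose,
      Finset.smul_sum, Matrix.mul_smul, Matrix.smul_mul]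

/-- Realification of a selective quantum operation: with
`A' i j = realify (A i j)` and `ρ' = (1/2) • realify ρ`, (a) the `A' i j`
satisfy `∑ i ∑ j (A' i j)ᵀ (A' i j) = I`, (b) `ρ'` is a real density matrix,
and (c) all trace statistics agree:
`tr (F'_{r k} ∘ ⋯ ∘ F'_{r 1}(ρ')) = tr (F_{r k} ∘ ⋯ ∘ F_{r 1}(ρ))` for every
`k ≥ 1` and every outcome sequence `r`. -/
theorem stmt7 (n m l : ℕ)
    (A : Fin (m + 1) → Fin l → Matrix (Fin n) (Fin n) ℂ)
    (hA : ∑ i, ∑ j, (A i j)ᴴ * A i j = 1)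
    (ρ : Matrix (Fin n) (Fin n) ℂ) (hρ : ρ.PosSemidef) (hρtr : ρ.trace = 1) :
    (∑ i, ∑ j, (realify (A i j))ᵀ * realify (A i j) = 1) ∧
    ((2 : ℝ)⁻¹ • realify ρ).PosSemidef ∧
    ((2 : ℝ)⁻¹ • realify ρ).trace = 1 ∧
    ∀ k : ℕ, 1 ≤ k → ∀ r : ℕ → Fin (m + 1),
      (FcState A r ρ k).trace =
        (((FrState (fun i j => realify (A i j)) r
            ((2 : ℝ)⁻¹ • realify ρ) k).trace : ℝ) : ℂ) := by
  refine ⟨?_, (realify_posSemidef hρ).smul (by norm_num), ?_, fun k _ r => ?_⟩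
  · simpa only [realify_sum, realify_mul, realify_conjTranspose, realify_one] using
      congrArg realify hA
  · simp [trace_smul, trace_realify, hρtr]
  · have him := (Complex.nonneg_iff.mp (FcState_posSemidef A r hρ k).trace_nonneg).2
    rw [FrState_smul_realify, trace_smul, trace_realify, smul_eq_mul,
      inv_mul_cancel_left₀ two_ne_zero]
    exact Complex.ext rfl him.symm
end

section
/- For every real algebraic number α there exists a positive real constant C₅ (depending only on α) such that for every integer N ≥ 2 and every integer polynomial p with deg(p) ≤ N and ‖p‖ ≤ 2^{2N}, if p(α) ≠ 0 then |p(α)| ≥ 2^{−C₅ N²}. -/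
open Polynomial

/-- `‖f‖` for an integer polynomial `f`: the maximum of the absolute values of
its coefficients, as a real number. -/
def intPolyNorm (f : Polynomial ℤ) : ℝ :=
  (((Finset.range (f.natDegree + 1)).sup fun j => (f.coeff j).natAbs : ℕ) : ℝ)

theorem natAbs_coeff_le_intPolyNorm (p : ℤ[X]) (j : ℕ) :
    ((p.coeff j).natAbs : ℝ) ≤ intPolyNorm p := by
  unfold intPolyNorm
  norm_cast
  by_cases hj : j ≤ p.natDegree
  · exact Finset.le_sup (f := fun j => (p.coeff j).natAbs)
      (Finset.mem_range.2 (Nat.lt_succ_of_le hj))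
  · simp [coeff_eq_zero_of_natDegree_lt (not_le.1 hj)]

theorem norm_aeval_le_of_natDegree_le (p : ℤ[X]) {N : ℕ} (hN : p.natDegree ≤ N) {z : ℂ} {M : ℝ}
    (hM : 1 ≤ M) (hz : ‖z‖ ≤ M) :
    ‖aeval z p‖ ≤ (N + 1) * intPolyNorm p * M ^ N := by
  rw [aeval_eq_sum_range' (Nat.lt_succ_of_le hN)]
  refine (norm_sum_le_of_le _ (f := fun i => p.coeff i • z ^ i)
    (n := fun _ => intPolyNorm p * M ^ N) fun i hi => ?_).trans (le_of_eq ?_)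
  · have hi : i ≤ N := Nat.lt_succ_iff.1 (Finset.mem_range.1 hi)
    rw [zsmul_eq_mul, norm_mul, norm_pow, Complex.norm_intCast, ← Int.cast_abs,
      Int.abs_eq_natAbs, Int.cast_natCast]
    have h0 : ‖z‖ ^ i ≤ M ^ N :=
      (pow_le_pow_left₀ (norm_nonneg z) hz i).trans (pow_le_pow_right₀ hM hi)
    exact mul_le_mul (natAbs_coeff_le_intPolyNorm p i) h0 (by positivity)
      ((Nat.cast_nonneg _).trans (natAbs_coeff_le_intPolyNorm p i))
  · simp [mul_assoc]

/-- A nonzero algebraic integer has norm at least one. -/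
theorem one_le_prod_norm_embeddings {K : Type*} [Field K] [NumberField K] {x : K}
    (hx : IsIntegral ℤ x) (h0 : x ≠ 0) : 1 ≤ ∏ σ : K →ₐ[ℚ] ℂ, ‖σ x‖ := by
  obtain ⟨n, hn⟩ := IsIntegrallyClosed.isIntegral_iff.1 (Algebra.isIntegral_norm ℚ hx)
  have hn0 : n ≠ 0 := by
    rintro rfl
    exact Algebra.norm_ne_zero_iff.2 h0 (by rw [← hn, map_zero])
  rw [← norm_prod, ← Algebra.norm_eq_prod_embeddings ℚ ℂ x, ← hn]
  simpa using (by exact_mod_cast Int.one_le_abs hn0 : (1 : ℝ) ≤ |(n : ℝ)|)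

/-- Liouville's inequality for the values of integer polynomials at an element of a number field. -/
theorem exists_one_le_norm_aeval_mul_pow {K : Type*} [Field K] [NumberField K] (x : K)
    (τ : K →ₐ[ℚ] ℂ) :
    ∃ B : ℝ, 1 < B ∧ ∀ N : ℕ, ∀ p : ℤ[X], p.natDegree ≤ N → intPolyNorm p ≤ 2 ^ (2 * N) →
      aeval x p ≠ 0 → 1 ≤ ‖aeval (τ x) p‖ * B ^ N := by
  classical
  obtain ⟨a, ha0, ha⟩ :=
    ((IsFractionRing.isAlgebraic_iff ℤ ℚ K).2 (IsAlgebraic.of_finite ℚ x)).exists_integral_multiple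
  have ha1 : (1 : ℝ) ≤ |(a : ℝ)| := by exact_mod_cast Int.one_le_abs ha0
  set M : ℝ := 1 + ∑ σ : K →ₐ[ℚ] ℂ, ‖σ x‖
  have hσM (σ : K →ₐ[ℚ] ℂ) : ‖σ x‖ ≤ M :=
    (Finset.single_le_sum (f := fun σ : K →ₐ[ℚ] ℂ => ‖σ x‖) (fun _ _ => norm_nonneg _)
      (Finset.mem_univ σ)).trans (le_add_of_nonneg_left zero_le_one)
  have hM : 1 ≤ M := le_add_of_nonneg_right (Finset.sum_nonneg fun _ _ => norm_nonneg _)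
  set A : ℝ := |(a : ℝ)| * (8 * M)
  have hA : 1 < A := by nlinarith
  refine ⟨A ^ Fintype.card (K →ₐ[ℚ] ℂ), one_lt_pow₀ hA (Fintype.card_pos_iff.2 ⟨τ⟩).ne', ?_⟩
  intro N p hN hp h0
  have hint : IsIntegral ℤ (a ^ N • aeval x p) := by
    rw [aeval_eq_sum_range' (Nat.lt_succ_of_le hN), Finset.smul_sum]
    refine IsIntegral.sum _ fun i hi => ?_
    have hi : i ≤ N := Nat.lt_succ_iff.1 (Finset.mem_range.1 hi)
    have : a ^ N • p.coeff i • x ^ i = (a ^ (N - i) * p.coeff i) • (a • x) ^ i := by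
      rw [_root_.smul_pow, smul_smul, smul_smul, mul_right_comm, ← pow_sub_mul_pow a hi]
    rw [this]
    exact (ha.pow i).smul _
  have hval (σ : K →ₐ[ℚ] ℂ) :
      ‖σ (a ^ N • aeval x p)‖ = |(a : ℝ)| ^ N * ‖aeval (σ x) p‖ := by
    have : σ (aeval x p) = aeval (σ x) p := (aeval_algHom_apply (σ.restrictScalars ℤ) x p).symm
    rw [map_zsmul, this, zsmul_eq_mul, norm_mul, Complex.norm_intCast]
    simp
  have hbound (σ : K →ₐ[ℚ] ℂ) : ‖σ (a ^ N • aeval x p)‖ ≤ A ^ N := by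
    rw [hval, mul_pow, mul_pow]
    have h2 : ((N : ℝ) + 1) ≤ 2 ^ N := by exact_mod_cast Nat.lt_two_pow_self
    have h8 : (2 : ℝ) ^ N * 2 ^ (2 * N) = 8 ^ N := by
      rw [pow_mul, ← mul_pow]
      norm_num
    refine mul_le_mul_of_nonneg_left ?_ (by positivity)
    refine (norm_aeval_le_of_natDegree_le p hN hM (hσM σ)).trans ?_
    rw [← h8]
    gcongr
    exact Nat.cast_nonneg _
  have hτ : ‖τ (a ^ N • aeval x p)‖ ≤ ‖aeval (τ x) p‖ * A ^ N := by
    rw [hval, mul_comm]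
    refine mul_le_mul_of_nonneg_left (pow_le_pow_left₀ (abs_nonneg _) ?_ N) (norm_nonneg _)
    exact le_mul_of_one_le_right (abs_nonneg _) (by linarith)
  have hne : a ^ N • aeval x p ≠ 0 := smul_ne_zero (pow_ne_zero N ha0) h0
  calc
    1 ≤ ∏ σ : K →ₐ[ℚ] ℂ, ‖σ (a ^ N • aeval x p)‖ := one_le_prod_norm_embeddings hint hne
    _ = ‖τ (a ^ N • aeval x p)‖ *
        ∏ σ ∈ Finset.univ.erase τ, ‖σ (a ^ N • aeval x p)‖ :=
      (Finset.mul_prod_erase _ _ (Finset.mem_univ τ)).symm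
    _ ≤ (‖aeval (τ x) p‖ * A ^ N) * ∏ _σ ∈ Finset.univ.erase τ, A ^ N := by
      gcongr with σ
      exact hbound σ
    _ = ‖aeval (τ x) p‖ * ∏ _σ : K →ₐ[ℚ] ℂ, A ^ N := by
      rw [mul_assoc, Finset.mul_prod_erase _ (fun _ => A ^ N) (Finset.mem_univ τ)]
    _ = ‖aeval (τ x) p‖ * (A ^ Fintype.card (K →ₐ[ℚ] ℂ)) ^ N := by
      rw [Finset.prod_const, Finset.card_univ, pow_right_comm]

/-- For every real algebraic number `α` there is a constant `C₅ > 0` such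
that for every integer `N ≥ 2` and every integer polynomial `p` with
`deg p ≤ N` and `‖p‖ ≤ 2^{2N}`, if `p(α) ≠ 0` then `|p(α)| ≥ 2^{-C₅ N²}`. -/
theorem stmt12 (α : ℝ) (hα : IsAlgebraic ℤ α) :
    ∃ C₅ : ℝ, 0 < C₅ ∧ ∀ N : ℕ, 2 ≤ N → ∀ p : Polynomial ℤ,
      p.natDegree ≤ N → intPolyNorm p ≤ 2 ^ (2 * N) →
      Polynomial.aeval α p ≠ 0 →
      (2 : ℝ) ^ (-(C₅ * (N : ℝ) ^ 2)) ≤ |Polynomial.aeval α p| := by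
  have hαQ : IsIntegral ℚ α := ((IsFractionRing.isAlgebraic_iff ℤ ℚ ℝ).1 hα).isIntegral
  have : FiniteDimensional ℚ (IntermediateField.adjoin ℚ {α}) :=
    IntermediateField.adjoin.finiteDimensional hαQ
  have : NumberField (IntermediateField.adjoin ℚ {α}) := ⟨⟩
  set x := IntermediateField.AdjoinSimple.gen ℚ α
  let ι : IntermediateField.adjoin ℚ {α} →ₐ[ℚ] ℝ := (IntermediateField.adjoin ℚ {α}).val
  let τ : IntermediateField.adjoin ℚ {α} →ₐ[ℚ] ℂ := (Complex.ofRealAm.restrictScalars ℚ).comp ι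
  obtain ⟨B, hB, h⟩ := exists_one_le_norm_aeval_mul_pow x τ
  have hB0 : 0 < B := zero_lt_one.trans hB
  refine ⟨Real.logb 2 B, Real.logb_pos one_lt_two hB, fun N hN p hdeg hp h0 => ?_⟩
  have hx : aeval α p = ι (aeval x p) :=
    aeval_algHom_apply (ι.restrictScalars ℤ) x p
  have hτ : aeval (τ x) p = ((aeval α p : ℝ) : ℂ) := by
    rw [hx]
    exact aeval_algHom_apply (τ.restrictScalars ℤ) x p
  have key := h N p hdeg hp fun hz => h0 (by rw [hx, hz, map_zero])
  rw [hτ, Complex.norm_real, Real.norm_eq_abs] at key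
  have hpow : (2 : ℝ) ^ (Real.logb 2 B * (N : ℝ) ^ 2) = B ^ (N ^ 2) := by
    rw [Real.rpow_mul zero_le_two, Real.rpow_logb zero_lt_two (by norm_num) hB0]
    exact_mod_cast Real.rpow_natCast B (N ^ 2)
  rw [Real.rpow_neg zero_le_two, hpow, inv_le_iff_one_le_mul₀ (by positivity)]
  refine key.trans ?_
  gcongr
  · exact hB.le
  · exact Nat.le_self_pow two_ne_zero N
end

section
/- For every real algebraic number α there exists a positive real constant C (depending only on α) such that the following holds: for every integer N ≥ 2 and all bivariate integer polynomials g(X,Y) and h(X,Y) of total degree at most N with ‖g‖ ≤ 2^N and ‖h‖ ≤ 2^N, if the limit L = lim_{z→1⁻} g(α,z)/h(α,z) exists and L ≠ 0, then |L| ≥ 2^{−C N²}. -/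
open Filter

/-- `‖f‖` for a bivariate integer polynomial `f`: the maximum of the absolute
values of its coefficients, as a real number. -/
def mvPolyNorm (f : MvPolynomial (Fin 2) ℤ) : ℝ :=
  ((f.support.sup fun mo => (MvPolynomial.coeff mo f).natAbs : ℕ) : ℝ)

/-- Evaluation of a bivariate integer polynomial at the real point `(x, y)`,
where variable `0` is `X` and variable `1` is `Y`. -/
noncomputable def biEval (f : MvPolynomial (Fin 2) ℤ) (x y : ℝ) : ℝ :=
  MvPolynomial.aeval ![x, y] f

/-- Liouville-type bound: a nonzero value at `α` of an integer combination of powers is bounded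
below in terms of its length and degree. -/
theorem exists_one_le_abs_sum_mul_pow (α : ℝ) (hα : IsAlgebraic ℤ α) :
    ∃ c : ℝ, 1 ≤ c ∧ |α| ≤ c ∧ ∃ d : ℕ, ∀ (N : ℕ) (M : ℝ), 1 ≤ M →
      ∀ {ι : Type} (s : Finset ι) (w : ι → ℤ) (e : ι → ℕ), (∀ i ∈ s, e i ≤ N) →
      (∑ i ∈ s, |(w i : ℝ)| ≤ M) → (∑ i ∈ s, (w i : ℝ) * α ^ e i ≠ 0) →
      1 ≤ |∑ i ∈ s, (w i : ℝ) * α ^ e i| * (c ^ N * M) ^ d := by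
  classical
  have hαQ : IsIntegral ℚ α := ((IsFractionRing.isAlgebraic_iff ℤ ℚ ℝ).mp hα).isIntegral
  let K := IntermediateField.adjoin ℚ {α}
  have : FiniteDimensional ℚ K := IntermediateField.adjoin.finiteDimensional hαQ
  let θ : K := IntermediateField.AdjoinSimple.gen ℚ α
  have hθα : algebraMap K ℝ θ = α := IntermediateField.AdjoinSimple.algebraMap_gen ℚ α
  have hθ : IsAlgebraic ℤ θ := by
    rw [← hθα] at hα
    exact (isAlgebraic_algebraMap_iff (algebraMap K ℝ).injective).mp hα
  obtain ⟨a, ha0, ha⟩ := hθ.exists_integral_multiple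
  have ha1 : (1 : ℝ) ≤ |(a : ℝ)| := by exact_mod_cast Int.one_le_abs ha0
  let φ : K →ₐ[ℚ] ℂ := (Algebra.ofId ℝ ℂ |>.restrictScalars ℚ).comp (IsScalarTower.toAlgHom ℚ K ℝ)
  have hφ (x : K) : ‖φ x‖ = |algebraMap K ℝ x| := by
    change ‖((algebraMap K ℝ x : ℝ) : ℂ)‖ = _
    simp
  let R : ℝ := 1 + ∑ σ : K →ₐ[ℚ] ℂ, ‖σ θ‖
  have hR1 : 1 ≤ R := le_add_of_nonneg_right (Finset.sum_nonneg fun _ _ => norm_nonneg _)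
  have hRσ (σ : K →ₐ[ℚ] ℂ) : ‖σ θ‖ ≤ R := by
    have := Finset.single_le_sum (f := fun σ : K →ₐ[ℚ] ℂ => ‖σ θ‖)
      (fun _ _ => norm_nonneg _) (Finset.mem_univ σ)
    exact this.trans (le_add_of_nonneg_left zero_le_one)
  have hc1 : 1 ≤ |(a : ℝ)| * R := one_le_mul_of_one_le_of_one_le ha1 hR1
  refine ⟨|(a : ℝ)| * R, hc1, ?_, Fintype.card (K →ₐ[ℚ] ℂ) + 1, ?_⟩
  · have h1 := hRσ φ
    rw [hφ, hθα] at h1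
    nlinarith
  intro N M hM ι s w e he hw hne
  let x : K := ∑ i ∈ s, (w i : K) * θ ^ e i
  have hx : algebraMap K ℝ x = ∑ i ∈ s, (w i : ℝ) * α ^ e i := by
    simp [x, map_sum, map_mul, map_pow, hθα]
  have hx0 : x ≠ 0 := by
    intro h
    rw [h, map_zero] at hx
    exact hne hx.symm
  have hint : IsIntegral ℤ ((a : K) ^ N * x) := by
    have hE : (a : K) ^ N * x = ∑ i ∈ s, (w i : K) * (a : K) ^ (N - e i) * (a • θ) ^ e i := by
      rw [Finset.mul_sum]
      refine Finset.sum_congr rfl fun i hi => ?_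
      rw [zsmul_eq_mul, mul_pow, ← pow_sub_mul_pow (a : K) (he i hi)]
      ring
    rw [hE]
    refine IsIntegral.sum _ fun i _ => ?_
    exact ((isIntegral_algebraMap (R := ℤ) (x := w i)).mul
      ((isIntegral_algebraMap (R := ℤ) (x := a)).pow _)).mul (ha.pow _)
  have haK : (a : K) ≠ 0 := by exact_mod_cast ha0
  have hy0 : (a : K) ^ N * x ≠ 0 := mul_ne_zero (pow_ne_zero _ haK) hx0
  have hnorm : 1 ≤ ∏ σ : K →ₐ[ℚ] ℂ, ‖σ ((a : K) ^ N * x)‖ := by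
    obtain ⟨k, hk⟩ := IsIntegrallyClosed.isIntegral_iff.mp (Algebra.isIntegral_norm ℚ hint)
    have hk0 : k ≠ 0 := by
      rintro rfl
      rw [map_zero] at hk
      exact hy0 (Algebra.norm_eq_zero_iff.mp hk.symm)
    have h := Algebra.norm_eq_prod_embeddings ℚ ℂ ((a : K) ^ N * x)
    rw [← norm_prod, ← h, ← hk]
    simp only [eq_intCast, map_intCast, Complex.norm_intCast]
    exact_mod_cast Int.one_le_abs hk0
  have hbound (σ : K →ₐ[ℚ] ℂ) :
      ‖σ ((a : K) ^ N * x)‖ ≤ (|(a : ℝ)| * R) ^ N * M := by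
    have h1 : ‖σ x‖ ≤ M * R ^ N := by
      have : σ x = ∑ i ∈ s, (w i : ℂ) * (σ θ) ^ e i := by simp [x]
      rw [this]
      refine (norm_sum_le _ _).trans (le_trans ?_
        (mul_le_mul_of_nonneg_right hw (by positivity)))
      rw [Finset.sum_mul]
      refine Finset.sum_le_sum fun i hi => ?_
      rw [norm_mul, norm_pow, Complex.norm_intCast]
      gcongr
      exact (pow_le_pow_left₀ (norm_nonneg _) (hRσ σ) _).trans (pow_le_pow_right₀ hR1 (he i hi))
    rw [map_mul, map_pow, map_intCast, norm_mul, norm_pow, Complex.norm_intCast, mul_pow]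
    calc |(a : ℝ)| ^ N * ‖σ x‖ ≤ |(a : ℝ)| ^ N * (M * R ^ N) := by gcongr
      _ = _ := by ring
  set B := (|(a : ℝ)| * R) ^ N * M
  have hB1 : 1 ≤ B := one_le_mul_of_one_le_of_one_le (one_le_pow₀ hc1) hM
  rw [← Finset.mul_prod_erase _ _ (Finset.mem_univ φ)] at hnorm
  have herase : ∏ σ ∈ Finset.univ.erase φ, ‖σ ((a : K) ^ N * x)‖ ≤
      B ^ Fintype.card (K →ₐ[ℚ] ℂ) := by
    refine (Finset.prod_le_prod (fun _ _ => norm_nonneg _) fun σ _ => hbound σ).trans ?_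
    rw [Finset.prod_const]
    exact pow_le_pow_right₀ hB1 (Finset.card_le_univ _)
  have hφx : ‖φ ((a : K) ^ N * x)‖ ≤ |∑ i ∈ s, (w i : ℝ) * α ^ e i| * B := by
    rw [hφ, map_mul, hx, map_pow, map_intCast, abs_mul, abs_pow, mul_comm]
    refine mul_le_mul_of_nonneg_left ?_ (abs_nonneg _)
    calc |(a : ℝ)| ^ N ≤ (|(a : ℝ)| * R) ^ N := by
          gcongr; exact le_mul_of_one_le_right (abs_nonneg _) hR1
      _ ≤ _ := le_mul_of_one_le_right (by positivity) hM
  refine hnorm.trans ((mul_le_mul hφx herase (Finset.prod_nonneg fun _ _ => norm_nonneg _)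
    (by positivity)).trans_eq ?_)
  ring

/-- If a quotient of real polynomials has a nonzero left limit at `a`, then this limit is the
quotient of the leading Taylor coefficients at `a`. -/
theorem Polynomial.exists_taylor_coeff_eq_of_tendsto_div (G H : Polynomial ℝ) (a L : ℝ)
    (hH : ∀ᶠ z in nhdsWithin a (Set.Iio a), H.eval z ≠ 0)
    (hL : Tendsto (fun z => G.eval z / H.eval z) (nhdsWithin a (Set.Iio a)) (nhds L))
    (hL0 : L ≠ 0) :
    ∃ m, (taylor a G).coeff m ≠ 0 ∧ (taylor a G).coeff m = L * (taylor a H).coeff m := by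
  have hH0 : H ≠ 0 := by
    rintro rfl
    obtain ⟨z, hz⟩ := hH.exists
    simp at hz
  have hG0 : G ≠ 0 := by
    rintro rfl
    simp only [eval_zero, zero_div] at hL
    exact hL0 (tendsto_nhds_unique hL tendsto_const_nhds)
  have key (P : Polynomial ℝ) (hP : P ≠ 0) : ∃ m Q, P = (X - C a) ^ m * Q ∧ Q.eval a ≠ 0 ∧
      (taylor a P).coeff m = Q.eval a := by
    obtain ⟨Q, hQ, hd⟩ := exists_eq_pow_rootMultiplicity_mul_and_not_dvd P hP a
    generalize rootMultiplicity a P = k at hQ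
    refine ⟨k, Q, hQ, fun h => hd (dvd_iff_isRoot.mpr h), ?_⟩
    rw [hQ]
    rw [taylor_mul, taylor_pow]
    simp [taylor_X, taylor_C, coeff_X_pow_mul']
  obtain ⟨m, G₁, hG, hG1, hGm⟩ := key G hG0
  obtain ⟨n, H₁, hHe, hH1, hHn⟩ := key H hH0
  have hcont (P : Polynomial ℝ) :
      Tendsto (fun z => P.eval z) (nhdsWithin a (Set.Iio a)) (nhds (P.eval a)) :=
    P.continuous.continuousAt.tendsto.mono_left nhdsWithin_le_nhds
  have heq : ∀ᶠ z in nhdsWithin a (Set.Iio a),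
      z - a ≠ 0 ∧ (z - a) ^ m * G₁.eval z =
        G.eval z / H.eval z * ((z - a) ^ n * H₁.eval z) := by
    filter_upwards [hH, self_mem_nhdsWithin] with z hz hza
    refine ⟨sub_ne_zero.mpr (ne_of_lt hza), ?_⟩
    have h1 : G.eval z = (z - a) ^ m * G₁.eval z := by
      conv_lhs => rw [hG]
      simp
    have h2 : H.eval z = (z - a) ^ n * H₁.eval z := by
      conv_lhs => rw [hHe]
      simp
    rw [← h1, ← h2, div_mul_cancel₀ _ hz]
  rcases lt_trichotomy m n with hmn | hmn | hmn
  · exfalso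
    obtain ⟨k, hk0, rfl⟩ := Nat.exists_eq_add_of_lt hmn |>.imp fun k hk => And.intro trivial hk
    have h := hL.mul (hcont ((X - C a) ^ (k + 1) * H₁))
    have h' := (hcont G₁).congr' (f₂ := fun z => G.eval z / H.eval z *
        ((X - C a) ^ (k + 1) * H₁).eval z) (by
      filter_upwards [heq] with z hz
      refine mul_left_cancel₀ (pow_ne_zero m hz.1) (hz.2.trans ?_)
      simp only [eval_mul, eval_pow, eval_sub, eval_X, eval_C]
      ring)
    exact hG1 ((tendsto_nhds_unique h' h).trans (by simp))
  · subst hmn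
    refine ⟨m, hGm ▸ hG1, ?_⟩
    rw [hGm, hHn]
    refine tendsto_nhds_unique (hcont G₁) ((hL.mul (hcont H₁)).congr' ?_)
    filter_upwards [heq] with z hz
    refine mul_left_cancel₀ (pow_ne_zero m hz.1) (Eq.trans ?_ hz.2.symm)
    ring
  · exfalso
    obtain ⟨k, hk0, rfl⟩ := Nat.exists_eq_add_of_lt hmn |>.imp fun k hk => And.intro trivial hk
    have h := hcont ((X - C a) ^ (k + 1) * G₁)
    have h' := (hL.mul (hcont H₁)).congr' (f₂ := fun z => ((X - C a) ^ (k + 1) * G₁).eval z) (by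
      filter_upwards [heq] with z hz
      refine mul_left_cancel₀ (pow_ne_zero n hz.1) (Eq.trans ?_ (hz.2.symm.trans ?_))
      · ring
      · simp only [eval_mul, eval_pow, eval_sub, eval_X, eval_C]
        ring)
    exact mul_ne_zero hL0 hH1 ((tendsto_nhds_unique h' h).trans (by simp))

/-- The polynomial `f(α, Y)`, as a real polynomial in `Y`. -/
noncomputable def specializeFst (f : MvPolynomial (Fin 2) ℤ) (α : ℝ) : Polynomial ℝ :=
  ∑ mo ∈ f.support, Polynomial.monomial (mo 1) (((f.coeff mo : ℤ) : ℝ) * α ^ mo 0)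

theorem eval_specializeFst (f : MvPolynomial (Fin 2) ℤ) (α z : ℝ) :
    (specializeFst f α).eval z = biEval f α z := by
  simp [specializeFst, biEval, MvPolynomial.aeval_def, MvPolynomial.eval₂_eq',
    Polynomial.eval_finsetSum, mul_assoc]

theorem taylor_one_coeff_specializeFst (f : MvPolynomial (Fin 2) ℤ) (α : ℝ) (m : ℕ) :
    (Polynomial.taylor 1 (specializeFst f α)).coeff m =
      ∑ mo ∈ f.support, ((f.coeff mo * (mo 1).choose m : ℤ) : ℝ) * α ^ mo 0 := by
  rw [Polynomial.taylor_coeff, specializeFst, map_sum, Polynomial.eval_finsetSum]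
  refine Finset.sum_congr rfl fun mo _ => ?_
  rw [Polynomial.hasseDeriv_monomial, Polynomial.eval_monomial]
  push_cast
  ring

theorem apply_le_of_totalDegree_le {f : MvPolynomial (Fin 2) ℤ} {N : ℕ} (hf : f.totalDegree ≤ N)
    {mo : Fin 2 →₀ ℕ} (hmo : mo ∈ f.support) (i : Fin 2) : mo i ≤ N := by
  have h := (MvPolynomial.le_totalDegree hmo).trans hf
  rw [Finsupp.sum_fintype _ _ (by simp), Fin.sum_univ_two] at h
  fin_cases i <;> simp <;> omega

theorem card_support_le {f : MvPolynomial (Fin 2) ℤ} {N : ℕ} (hf : f.totalDegree ≤ N) :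
    f.support.card ≤ (N + 1) * (N + 1) := by
  rw [← Finset.card_range (N + 1), ← Finset.card_product]
  refine Finset.card_le_card_of_injOn (fun mo => (mo 0, mo 1)) (fun mo hmo => ?_) ?_
  · have h0 := apply_le_of_totalDegree_le hf hmo 0
    have h1 := apply_le_of_totalDegree_le hf hmo 1
    simp only [Finset.coe_product, Set.mem_prod, Finset.coe_range, Set.mem_Iio]
    omega
  · intro x _ y _ h
    simp only [Prod.mk.injEq] at h
    ext i
    fin_cases i
    exacts [h.1, h.2]

theorem sum_abs_coeff_mul_choose_le {f : MvPolynomial (Fin 2) ℤ} {N : ℕ}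
    (hf : f.totalDegree ≤ N) (hn : mvPolyNorm f ≤ 2 ^ N) (m : ℕ) :
    ∑ mo ∈ f.support, |((f.coeff mo * (mo 1).choose m : ℤ) : ℝ)| ≤ 16 ^ N := by
  have hterm : ∀ mo ∈ f.support, |((f.coeff mo * (mo 1).choose m : ℤ) : ℝ)| ≤ 2 ^ N * 2 ^ N := by
    intro mo hmo
    push_cast
    rw [abs_mul, Nat.abs_cast]
    refine mul_le_mul (le_trans ?_ hn) ?_ (by positivity) (by positivity)
    · rw [mvPolyNorm, ← Int.cast_abs, Int.abs_eq_natAbs, Int.cast_natCast]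
      exact_mod_cast Finset.le_sup (f := fun mo => (MvPolynomial.coeff mo f).natAbs) hmo
    · exact_mod_cast (Nat.choose_le_two_pow _ _).trans
        (Nat.pow_le_pow_right two_pos (apply_le_of_totalDegree_le hf hmo 1))
  refine (Finset.sum_le_card_nsmul _ _ _ hterm).trans ?_
  have hN : N + 1 ≤ 2 ^ N := Nat.lt_two_pow_self
  have hcard : (f.support.card : ℝ) ≤ 2 ^ N * 2 ^ N := by
    exact_mod_cast (card_support_le hf).trans (Nat.mul_le_mul hN hN)
  rw [nsmul_eq_mul]
  refine (mul_le_mul_of_nonneg_right hcard (by positivity)).trans_eq ?_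
  rw [← mul_pow, ← mul_pow]
  norm_num

/-- For every real algebraic number `α` there is a constant `C > 0` such that
for every integer `N ≥ 2` and all bivariate integer polynomials `g`, `h` of
total degree at most `N` with `‖g‖, ‖h‖ ≤ 2^N`: if
`L = lim_{z → 1⁻} g(α, z) / h(α, z)` exists (with `h(α, z) ≠ 0` for `z`
sufficiently close to 1 from below) and `L ≠ 0`, then `|L| ≥ 2^{-C N²}`. -/
theorem stmt13 (α : ℝ) (hα : IsAlgebraic ℤ α) :
    ∃ C : ℝ, 0 < C ∧ ∀ N : ℕ, 2 ≤ N → ∀ g h : MvPolynomial (Fin 2) ℤ,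
      g.totalDegree ≤ N → h.totalDegree ≤ N →
      mvPolyNorm g ≤ 2 ^ N → mvPolyNorm h ≤ 2 ^ N →
      ∀ L : ℝ,
        (∀ᶠ z in nhdsWithin 1 (Set.Iio 1), biEval h α z ≠ 0) →
        Tendsto (fun z : ℝ => biEval g α z / biEval h α z)
          (nhdsWithin 1 (Set.Iio 1)) (nhds L) →
        L ≠ 0 →
        (2 : ℝ) ^ (-(C * (N : ℝ) ^ 2)) ≤ |L| := by
  obtain ⟨c, hc1, hαc, d, hd⟩ := exists_one_le_abs_sum_mul_pow α hα
  have hE1 : 1 < 16 * c := by linarith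
  refine ⟨Real.logb 2 (16 * c) * (d + 1),
    mul_pos (Real.logb_pos one_lt_two hE1) (by positivity), ?_⟩
  intro N hN g h hg hh hgn hhn L hz hlim hL0
  obtain ⟨m, hm0, hm⟩ := Polynomial.exists_taylor_coeff_eq_of_tendsto_div (specializeFst g α)
    (specializeFst h α) 1 L (by simpa only [eval_specializeFst] using hz)
    (by simpa only [eval_specializeFst] using hlim) hL0
  rw [taylor_one_coeff_specializeFst] at hm0 hm
  rw [taylor_one_coeff_specializeFst] at hm
  have hlow := hd N (16 ^ N) (one_le_pow₀ (by norm_num)) g.support _ _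
    (fun mo hmo => apply_le_of_totalDegree_le hg hmo 0) (sum_abs_coeff_mul_choose_le hg hgn m) hm0
  have hup : |∑ mo ∈ h.support, ((h.coeff mo * (mo 1).choose m : ℤ) : ℝ) * α ^ mo 0| ≤
      16 ^ N * c ^ N := by
    refine (Finset.abs_sum_le_sum_abs _ _).trans (le_trans ?_ (mul_le_mul_of_nonneg_right
      (sum_abs_coeff_mul_choose_le hh hhn m) (by positivity)))
    rw [Finset.sum_mul]
    refine Finset.sum_le_sum fun mo hmo => ?_
    rw [abs_mul, abs_pow]
    gcongr
    exact (pow_le_pow_left₀ (abs_nonneg _) hαc _).trans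
      (pow_le_pow_right₀ hc1 (apply_le_of_totalDegree_le hh hmo 0))
  rw [hm, abs_mul] at hlow
  have hmain : 1 ≤ |L| * (16 * c) ^ (N * (d + 1)) := by
    refine hlow.trans ?_
    calc _ ≤ |L| * (16 ^ N * c ^ N) * (c ^ N * 16 ^ N) ^ d := by gcongr
      _ = _ := by rw [pow_mul, mul_pow]; ring
  have hle : (16 * c) ^ (N * (d + 1)) ≤
      (2 : ℝ) ^ (Real.logb 2 (16 * c) * (d + 1) * (N : ℝ) ^ 2) := by
    rw [mul_assoc, Real.rpow_mul two_pos.le, Real.rpow_logb two_pos (by norm_num) (by linarith)]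
    rw [show ((d : ℝ) + 1) * (N : ℝ) ^ 2 = (((d + 1) * N ^ 2 : ℕ) : ℝ) by push_cast; ring,
      Real.rpow_natCast]
    refine pow_le_pow_right₀ hE1.le ?_
    rw [mul_comm]
    exact Nat.mul_le_mul_left _ (Nat.le_self_pow two_ne_zero N)
  rw [Real.rpow_neg two_pos.le, inv_le_iff_one_le_mul₀ (by positivity)]
  exact hmain.trans (mul_le_mul_of_nonneg_left hle (abs_nonneg _))
end

section
/- For every real algebraic number α there exist positive integer constants C₁ and C₂ (depending only on α) such that the following holds. Let N ≥ 2 be an integer and let g(X,Y) and h(X,Y) be bivariate integer polynomials of total degree at most N with ‖g‖ ≤ 2^N and ‖h‖ ≤ 2^N, such that the limit L = lim_{z→1⁻} g(α,z)/h(α,z) exists. Then: (a) |L − 2^{−C₁N²}| ≥ 2^{−C₁N²}; and (b) for every real ξ with 0 < ξ ≤ 2^{−C₂N²} and every real number α̃ with |α − α̃| ≤ ξ^{2N+1}, one has h(α̃, 1−ξ) ≠ 0 and |L − g(α̃, 1−ξ)/h(α̃, 1−ξ)| < 2^{−C₁N²}. -/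
open Filter

/-- A Liouville inequality: a polynomial that is bounded by `T` on a large disc and does not vanish
at the algebraic number `α` is bounded below at `α` by a negative power of `T`. -/
theorem exists_pow_le_abs_aeval (α : ℝ) (hα : IsAlgebraic ℤ α) :
    ∃ s t d : ℕ, |α| + 1 ≤ 2 ^ s ∧ ∀ (N : ℕ) (P : Polynomial ℤ) (T : ℝ), P.natDegree ≤ N → 1 ≤ T →
      (∀ w : ℂ, ‖w‖ ≤ 2 ^ s → ‖Polynomial.aeval w P‖ ≤ T) → Polynomial.aeval α P ≠ 0 →
      1 ≤ |Polynomial.aeval α P| * (2 ^ (t * N) * T) ^ d := by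
  have hαQ : IsIntegral ℚ α :=
    (hα.extendScalars (algebraMap ℤ ℚ).injective_int).isIntegral
  let K := IntermediateField.adjoin ℚ {α}
  have : FiniteDimensional ℚ K := IntermediateField.adjoin.finiteDimensional hαQ
  let γ : K := IntermediateField.AdjoinSimple.gen ℚ α
  have hγ : algebraMap K ℝ γ = α := IntermediateField.AdjoinSimple.algebraMap_gen ℚ α
  have hγalg : IsAlgebraic ℤ γ := by
    rw [← isAlgebraic_algebraMap_iff (algebraMap K ℝ).injective, hγ]
    exact hα
  obtain ⟨a, ha0, ha⟩ := hγalg.exists_integral_multiple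
  obtain ⟨t, ht⟩ := pow_unbounded_of_one_lt (|(a : ℝ)|) (one_lt_two)
  obtain ⟨s, hs⟩ := pow_unbounded_of_one_lt (|α| + 1 + ∑ σ : K →ₐ[ℚ] ℂ, ‖σ γ‖) (one_lt_two)
  have hsum : 0 ≤ ∑ σ : K →ₐ[ℚ] ℂ, ‖σ γ‖ := Finset.sum_nonneg fun _ _ => norm_nonneg _
  refine ⟨s, t, Fintype.card (K →ₐ[ℚ] ℂ), by linarith, fun N P T hP hT hbd hne => ?_⟩
  let σ₀ : K →ₐ[ℚ] ℂ := (Complex.ofRealAm.restrictScalars ℚ).comp (IsScalarTower.toAlgHom ℚ K ℝ)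
  have hσ (σ : K →ₐ[ℚ] ℂ) : σ (Polynomial.aeval γ P) = Polynomial.aeval (σ γ) P :=
    (Polynomial.aeval_algHom_apply (σ.restrictScalars ℤ) γ P).symm
  have hσ₀ : ‖σ₀ (Polynomial.aeval γ P)‖ = |Polynomial.aeval α P| := by
    have h1 : σ₀ γ = ((α : ℝ) : ℂ) := by
      change ((algebraMap K ℝ γ : ℝ) : ℂ) = _
      rw [hγ]
    have h2 : Polynomial.aeval ((α : ℝ) : ℂ) P = ((Polynomial.aeval α P : ℝ) : ℂ) :=
      Polynomial.aeval_algebraMap_apply ℂ α P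
    rw [hσ, h1, h2, Complex.norm_real, Real.norm_eq_abs]
  have hx : IsIntegral ℤ ((a : K) ^ N * Polynomial.aeval γ P) := by
    rw [Polynomial.aeval_eq_sum_range' (Nat.lt_succ_of_le hP), Finset.mul_sum]
    refine IsIntegral.sum _ fun i hi => ?_
    have hi' : i ≤ N := Nat.lt_succ_iff.mp (Finset.mem_range.mp hi)
    have : (a : K) ^ N * P.coeff i • γ ^ i =
        ((P.coeff i * a ^ (N - i) : ℤ) : K) * (a • γ) ^ i := by
      rw [← Nat.sub_add_cancel hi', pow_add]
      simp only [zsmul_eq_mul, Nat.sub_add_cancel hi', mul_pow]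
      push_cast
      ring
    rw [this]
    exact (isIntegral_algebraMap (R := ℤ) (A := K)).mul (ha.pow i)
  set x : K := (a : K) ^ N * Polynomial.aeval γ P with hxdef
  have hx0 : x ≠ 0 := by
    refine mul_ne_zero (pow_ne_zero _ (by exact_mod_cast ha0)) fun h => hne ?_
    rw [h, map_zero, norm_zero] at hσ₀
    exact abs_eq_zero.mp hσ₀.symm
  obtain ⟨n, hn⟩ := IsIntegrallyClosed.isIntegral_iff.mp (Algebra.isIntegral_norm ℚ hx)
  have hn0 : n ≠ 0 := by
    rintro rfl
    exact Algebra.norm_ne_zero_iff.mpr hx0 (by rw [← hn, map_zero])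
  have hprod : 1 ≤ ∏ σ : K →ₐ[ℚ] ℂ, ‖σ x‖ := by
    rw [← norm_prod, ← Algebra.norm_eq_prod_embeddings ℚ ℂ x, ← hn]
    simp only [algebraMap_int_eq, eq_intCast, map_intCast, Complex.norm_intCast]
    exact_mod_cast Int.one_le_abs hn0
  have hxn (σ : K →ₐ[ℚ] ℂ) : ‖σ x‖ = |(a : ℝ)| ^ N * ‖σ (Polynomial.aeval γ P)‖ := by
    rw [hxdef, map_mul, map_pow, map_intCast, norm_mul, norm_pow, Complex.norm_intCast]
  have haN : |(a : ℝ)| ^ N ≤ 2 ^ (t * N) := by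
    rw [pow_mul]
    exact pow_le_pow_left₀ (abs_nonneg _) ht.le N
  have hle (σ : K →ₐ[ℚ] ℂ) : ‖σ x‖ ≤ 2 ^ (t * N) * T := by
    rw [hxn, hσ]
    refine mul_le_mul haN (hbd _ ?_) (norm_nonneg _) (by positivity)
    have := Finset.single_le_sum (f := fun σ : K →ₐ[ℚ] ℂ => ‖σ γ‖)
      (fun _ _ => norm_nonneg _) (Finset.mem_univ σ)
    have := abs_nonneg α
    linarith
  classical
  rw [← Finset.mul_prod_erase _ _ (Finset.mem_univ σ₀)] at hprod
  refine hprod.trans ?_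
  have hcard : Fintype.card (K →ₐ[ℚ] ℂ) = (Finset.univ.erase σ₀).card + 1 := by
    rw [Finset.card_erase_add_one (Finset.mem_univ _), Finset.card_univ]
  rw [hcard, pow_succ', ← mul_assoc]
  refine mul_le_mul ?_ ?_ (Finset.prod_nonneg fun _ _ => norm_nonneg _) (by positivity)
  · rw [hxn, hσ₀, mul_comm]
    refine mul_le_mul_of_nonneg_left (haN.trans ?_) (abs_nonneg _)
    exact le_mul_of_one_le_right (by positivity) hT
  · rw [← Finset.prod_const]
    exact Finset.prod_le_prod (fun _ _ => norm_nonneg _) fun σ _ => hle σ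

open Polynomial in
/-- The coefficient of `y ^ k` in `f(X, 1 - y)`, as a polynomial in `X`. -/
noncomputable def shiftCoeff (f : MvPolynomial (Fin 2) ℤ) (k : ℕ) : ℤ[X] :=
  ∑ m ∈ f.support, C (MvPolynomial.coeff m f * ((-1) ^ k * (m 1).choose k)) * X ^ m 0

theorem biEval_eq_sum (f : MvPolynomial (Fin 2) ℤ) (x y : ℝ) :
    biEval f x y = ∑ m ∈ f.support, ((MvPolynomial.coeff m f : ℤ) : ℝ) * (x ^ m 0 * y ^ m 1) := by
  simp [biEval, MvPolynomial.aeval_def, MvPolynomial.eval₂_eq', Fin.prod_univ_two]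

theorem exponents_le_totalDegree {f : MvPolynomial (Fin 2) ℤ} {N : ℕ} (hf : f.totalDegree ≤ N)
    {m : Fin 2 →₀ ℕ} (hm : m ∈ f.support) : m 0 + m 1 ≤ N := by
  have h := (MvPolynomial.le_totalDegree hm).trans hf
  rwa [Finsupp.sum_fintype _ _ (fun _ => rfl), Fin.sum_univ_two] at h

theorem aeval_shiftCoeff {R : Type*} [CommRing R] (f : MvPolynomial (Fin 2) ℤ) (k : ℕ) (x : R) :
    Polynomial.aeval x (shiftCoeff f k) = ∑ m ∈ f.support,
      ((MvPolynomial.coeff m f : ℤ) : R) * ((-1) ^ k * (m 1).choose k * x ^ m 0) := by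
  simp [shiftCoeff, mul_assoc]

theorem natDegree_shiftCoeff_le {f : MvPolynomial (Fin 2) ℤ} {N : ℕ} (hf : f.totalDegree ≤ N)
    (k : ℕ) : (shiftCoeff f k).natDegree ≤ N := by
  refine Polynomial.natDegree_sum_le_of_forall_le _ _ fun m hm => ?_
  refine (Polynomial.natDegree_C_mul_X_pow_le _ _).trans ?_
  have := exponents_le_totalDegree hf hm
  omega

theorem biEval_one_sub {f : MvPolynomial (Fin 2) ℤ} {N : ℕ} (hf : f.totalDegree ≤ N)
    (x y : ℝ) : biEval f x (1 - y) =
      ∑ k ∈ Finset.range (N + 1), Polynomial.aeval x (shiftCoeff f k) * y ^ k := by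
  simp_rw [aeval_shiftCoeff, Finset.sum_mul]
  rw [Finset.sum_comm, biEval_eq_sum]
  refine Finset.sum_congr rfl fun m hm => ?_
  have hmN := exponents_le_totalDegree hf hm
  have hpow : (1 - y) ^ m 1 =
      ∑ k ∈ Finset.range (N + 1), (-1) ^ k * ((m 1).choose k : ℝ) * y ^ k := by
    rw [sub_eq_neg_add, add_pow]
    rw [← Finset.sum_subset (Finset.range_subset_range.mpr (by omega : m 1 + 1 ≤ N + 1))]
    · refine Finset.sum_congr rfl fun k _ => ?_
      rw [neg_pow]
      ring
    · intro k _ hk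
      rw [Finset.mem_range, not_lt] at hk
      rw [Nat.choose_eq_zero_of_lt (by omega)]
      simp
  rw [hpow, Finset.mul_sum, Finset.mul_sum]
  refine Finset.sum_congr rfl fun k _ => ?_
  ring

/-- A polynomial of degree and logarithmic height at most `N` has length at most `8 ^ N`. -/
theorem sum_abs_coeff_mul_le {f : MvPolynomial (Fin 2) ℤ} {N : ℕ} (hf : f.totalDegree ≤ N)
    (hn : mvPolyNorm f ≤ 2 ^ N) {F : (Fin 2 →₀ ℕ) → ℝ} {B : ℝ} (hB : 0 ≤ B)
    (hF : ∀ m ∈ f.support, F m ≤ B) :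
    ∑ m ∈ f.support, |((MvPolynomial.coeff m f : ℤ) : ℝ)| * F m ≤ 8 ^ N * B := by
  have hcoeff : ∀ m ∈ f.support, |((MvPolynomial.coeff m f : ℤ) : ℝ)| ≤ 2 ^ N := by
    intro m hm
    refine le_trans ?_ hn
    have h := Finset.le_sup (f := fun mo => (MvPolynomial.coeff mo f).natAbs) hm
    rw [mvPolyNorm, ← Int.cast_abs, ← Nat.cast_natAbs]
    exact_mod_cast h
  have hcard : f.support.card ≤ 2 ^ N * 2 ^ N := by
    calc f.support.card ≤ (Finset.range (N + 1) ×ˢ Finset.range (N + 1)).card := by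
          refine Finset.card_le_card_of_injOn (fun m => (m 0, m 1)) (fun m hm => ?_) ?_
          · have := exponents_le_totalDegree hf hm
            simp only [Finset.coe_product, Finset.coe_range, Set.mem_prod, Set.mem_Iio]
            omega
          · intro m _ m' _ h
            ext i
            simp only [Prod.mk.injEq] at h
            fin_cases i
            exacts [h.1, h.2]
      _ ≤ 2 ^ N * 2 ^ N := by
          rw [Finset.card_product, Finset.card_range]
          exact Nat.mul_le_mul Nat.lt_two_pow_self Nat.lt_two_pow_self
  calc ∑ m ∈ f.support, |((MvPolynomial.coeff m f : ℤ) : ℝ)| * F m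
      ≤ ∑ _m ∈ f.support, 2 ^ N * B := by
        refine Finset.sum_le_sum fun m hm => ?_
        exact (mul_le_mul_of_nonneg_left (hF m hm) (abs_nonneg _)).trans
          (mul_le_mul_of_nonneg_right (hcoeff m hm) hB)
    _ = f.support.card * (2 ^ N * B) := by rw [Finset.sum_const, nsmul_eq_mul]
    _ ≤ ((2 ^ N * 2 ^ N : ℕ) : ℝ) * (2 ^ N * B) := by gcongr
    _ = 8 ^ N * B := by
        rw [show (8 : ℝ) = 2 * 2 * 2 by norm_num, mul_pow, mul_pow]
        push_cast
        ring

theorem norm_aeval_shiftCoeff_le {𝕜 : Type*} [RCLike 𝕜] {f : MvPolynomial (Fin 2) ℤ} {N s : ℕ}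
    (hf : f.totalDegree ≤ N) (hn : mvPolyNorm f ≤ 2 ^ N) (k : ℕ) {w : 𝕜} (hw : ‖w‖ ≤ 2 ^ s) :
    ‖Polynomial.aeval w (shiftCoeff f k)‖ ≤ 2 ^ ((s + 4) * N) := by
  rw [aeval_shiftCoeff]
  refine (norm_sum_le _ _).trans ?_
  have hc (n : ℤ) : ‖(n : 𝕜)‖ = |(n : ℝ)| := by
    rw [← RCLike.ofReal_intCast, RCLike.norm_ofReal]
  simp_rw [norm_mul, hc]
  refine (sum_abs_coeff_mul_le hf hn (B := 2 ^ N * 2 ^ (s * N)) (by positivity) ?_).trans ?_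
  · intro m hm
    have hmN := exponents_le_totalDegree hf hm
    rw [norm_pow, norm_neg, norm_one, one_pow, one_mul, norm_pow, RCLike.norm_natCast]
    gcongr
    · have h : (m 1).choose k ≤ 2 ^ N :=
        (Nat.choose_le_two_pow _ _).trans (Nat.pow_le_pow_right two_pos (by omega))
      exact_mod_cast h
    · calc ‖w‖ ^ m 0 ≤ (2 ^ s) ^ m 0 := by gcongr
        _ ≤ (2 ^ s) ^ N := pow_le_pow_right₀ (one_le_pow₀ one_le_two) (by omega)
        _ = 2 ^ (s * N) := (pow_mul _ _ _).symm
  · rw [show (8 : ℝ) = 2 ^ 3 by norm_num, ← pow_mul, ← pow_add, ← pow_add]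
    exact pow_le_pow_right₀ one_le_two (by linarith)

theorem abs_biEval_sub_le {f : MvPolynomial (Fin 2) ℤ} {N s : ℕ}
    (hf : f.totalDegree ≤ N) (hn : mvPolyNorm f ≤ 2 ^ N) {x x' y : ℝ} (hx : |x| ≤ 2 ^ s)
    (hx' : |x'| ≤ 2 ^ s) (hy : 0 ≤ y) (hy1 : y ≤ 1) :
    |biEval f x y - biEval f x' y| ≤ 2 ^ ((s + 4) * N) * |x - x'| := by
  rw [biEval_eq_sum, biEval_eq_sum, ← Finset.sum_sub_distrib]
  simp_rw [← mul_sub]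
  refine (Finset.abs_sum_le_sum_abs _ _).trans ?_
  simp_rw [abs_mul]
  refine (sum_abs_coeff_mul_le hf hn (B := 2 ^ N * 2 ^ (s * N) * |x - x'|)
    (by positivity) ?_).trans ?_
  · intro m hm
    have hmN := exponents_le_totalDegree hf hm
    rw [← sub_mul, abs_mul, abs_pow, abs_of_nonneg hy]
    have h1 : |x ^ m 0 - x' ^ m 0| ≤ |x - x'| * m 0 * max |x| |x'| ^ (m 0 - 1) :=
      abs_pow_sub_pow_le x x' (m 0)
    have h2 : max |x| |x'| ^ (m 0 - 1) ≤ (2 : ℝ) ^ (s * N) := by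
      calc max |x| |x'| ^ (m 0 - 1) ≤ (2 ^ s) ^ (m 0 - 1) := by
            gcongr
            exact max_le hx hx'
        _ ≤ (2 ^ s) ^ N := pow_le_pow_right₀ (one_le_pow₀ one_le_two) (by omega)
        _ = 2 ^ (s * N) := (pow_mul _ _ _).symm
    have h3 : (m 0 : ℝ) ≤ 2 ^ N := by
      have : m 0 ≤ 2 ^ N := (by omega : m 0 ≤ N).trans Nat.lt_two_pow_self.le
      exact_mod_cast this
    calc |x ^ m 0 - x' ^ m 0| * y ^ m 1 ≤ |x ^ m 0 - x' ^ m 0| :=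
          mul_le_of_le_one_right (abs_nonneg _) (pow_le_one₀ hy hy1)
      _ ≤ |x - x'| * 2 ^ N * 2 ^ (s * N) := h1.trans (by gcongr)
      _ = 2 ^ N * 2 ^ (s * N) * |x - x'| := by ring
  · rw [← mul_assoc]
    refine mul_le_mul_of_nonneg_right ?_ (abs_nonneg _)
    rw [show (8 : ℝ) = 2 ^ 3 by norm_num, ← pow_mul, ← pow_add, ← pow_add]
    exact pow_le_pow_right₀ one_le_two (by linarith)

theorem abs_sum_mul_pow_sub_le {p : ℕ → ℝ} {T ξ : ℝ} {N l : ℕ} (hp : ∀ k, |p k| ≤ T)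
    (hz : ∀ k < l, p k = 0) (hl : l ≤ N) (hξ : 0 ≤ ξ) (hξ1 : ξ ≤ 1) :
    |∑ k ∈ Finset.range (N + 1), p k * ξ ^ k - ξ ^ l * p l| ≤ N * T * ξ ^ (l + 1) := by
  have hmem : l ∈ Finset.range (N + 1) := Finset.mem_range.mpr (by omega)
  rw [← Finset.add_sum_erase _ _ hmem, mul_comm (p l), add_sub_cancel_left]
  refine (Finset.abs_sum_le_sum_abs _ _).trans ?_
  have hT : 0 ≤ T := (abs_nonneg _).trans (hp 0)
  refine (Finset.sum_le_card_nsmul _ _ (T * ξ ^ (l + 1)) fun k hk => ?_).trans ?_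
  · rcases lt_or_gt_of_ne (Finset.ne_of_mem_erase hk) with h | h
    · rw [hz k h, zero_mul, abs_zero]
      positivity
    · rw [abs_mul, abs_of_nonneg (pow_nonneg hξ k)]
      exact mul_le_mul (hp k) (pow_le_pow_of_le_one hξ hξ1 h) (by positivity) hT
  · rw [Finset.card_erase_of_mem hmem, Finset.card_range, nsmul_eq_mul, Nat.add_sub_cancel,
      mul_assoc]

open Topology in
theorem tendsto_sum_mul_pow_div {p : ℕ → ℝ} {T : ℝ} {N l : ℕ} (hp : ∀ k, |p k| ≤ T)
    (hz : ∀ k < l, p k = 0) (hl : l ≤ N) :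
    Tendsto (fun ξ : ℝ => (∑ k ∈ Finset.range (N + 1), p k * ξ ^ k) / ξ ^ l)
      (𝓝[>] 0) (𝓝 (p l)) := by
  rw [tendsto_iff_norm_sub_tendsto_zero]
  have hlim : Tendsto (fun ξ : ℝ => N * T * ξ) (𝓝[>] 0) (𝓝 0) := by
    have : Tendsto (fun ξ : ℝ => N * T * ξ) (𝓝 0) (𝓝 (N * T * 0)) :=
      (continuous_const.mul continuous_id).tendsto 0
    rw [mul_zero] at this
    exact this.mono_left nhdsWithin_le_nhds
  refine squeeze_zero' (Eventually.of_forall fun _ => norm_nonneg _) ?_ hlim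
  filter_upwards [Ioo_mem_nhdsGT (zero_lt_one' ℝ)] with ξ hξ
  have hpos : 0 < ξ ^ l := pow_pos hξ.1 l
  have h := abs_sum_mul_pow_sub_le hp hz hl hξ.1.le hξ.2.le
  rw [Real.norm_eq_abs, div_sub' hpos.ne', abs_div, abs_of_pos hpos, div_le_iff₀ hpos]
  rw [pow_succ'] at h
  linarith

open Topology in
/-- If a quotient of power sums has a limit at `0⁺`, then the numerator vanishes at least to the
order of the denominator and the limit is the quotient of the leading coefficients. -/
theorem coeff_eq_of_tendsto_div {p q : ℕ → ℝ} {T L : ℝ} {N l : ℕ} (hp : ∀ k, |p k| ≤ T)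
    (hq : ∀ k, |q k| ≤ T) (hz : ∀ k < l, q k = 0) (hl : l ≤ N) (hql : q l ≠ 0)
    (hL : Tendsto (fun ξ : ℝ => (∑ k ∈ Finset.range (N + 1), p k * ξ ^ k) /
      ∑ k ∈ Finset.range (N + 1), q k * ξ ^ k) (𝓝[>] 0) (𝓝 L)) :
    (∀ k < l, p k = 0) ∧ p l = L * q l := by
  have hQ := tendsto_sum_mul_pow_div hq hz hl
  have hP : Tendsto (fun ξ : ℝ => (∑ k ∈ Finset.range (N + 1), p k * ξ ^ k) / ξ ^ l)
      (𝓝[>] 0) (𝓝 (L * q l)) := by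
    refine (hL.mul hQ).congr' ?_
    filter_upwards [hQ.eventually_ne hql] with ξ hξ
    have : ∑ k ∈ Finset.range (N + 1), q k * ξ ^ k ≠ 0 := fun h => hξ (by rw [h, zero_div])
    field_simp
  have hpz : ∀ k < l, p k = 0 := by
    intro k
    induction k using Nat.strong_induction_on with
    | _ k ih =>
      intro hk
      have h1 := tendsto_sum_mul_pow_div hp (fun i hi => ih i hi (hi.trans hk)) (hk.le.trans hl)
      have h2 : Tendsto (fun ξ : ℝ => ξ ^ (l - k)) (𝓝[>] 0) (𝓝 0) := by
        have : Tendsto (fun ξ : ℝ => ξ ^ (l - k)) (𝓝 0) (𝓝 (0 ^ (l - k))) :=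
          (continuous_pow _).tendsto 0
        rw [zero_pow (by omega)] at this
        exact this.mono_left nhdsWithin_le_nhds
      have h3 := h2.mul hP
      rw [zero_mul] at h3
      refine tendsto_nhds_unique (h1.congr' ?_) h3
      filter_upwards [self_mem_nhdsWithin] with ξ hξ
      have hξ0 : ξ ≠ 0 := ne_of_gt hξ
      have : ξ ^ l = ξ ^ (l - k) * ξ ^ k := by rw [← pow_add, Nat.sub_add_cancel hk.le]
      rw [this]
      field_simp
  exact ⟨hpz, tendsto_nhds_unique (tendsto_sum_mul_pow_div hp hpz hl) hP⟩

/-- Perturbing both the first variable and the second one changes the value of `f` at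
`(x, 1 - ξ)` only in relative order `ξ` above its leading term. -/
theorem exists_biEval_eq_pow_mul {f : MvPolynomial (Fin 2) ℤ} {N s l : ℕ}
    (hf : f.totalDegree ≤ N) (hn : mvPolyNorm f ≤ 2 ^ N) {x x' ξ : ℝ} (hx : |x| ≤ 2 ^ s)
    (hx' : |x'| ≤ 2 ^ s) (hξ : 0 < ξ) (hξ1 : ξ ≤ 1) (hxx : |x - x'| ≤ ξ ^ (2 * N + 1))
    (hl : l ≤ N) (hz : ∀ k < l, Polynomial.aeval x (shiftCoeff f k) = 0) :
    ∃ u : ℝ, |u| ≤ 2 ^ ((s + 5) * N) ∧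
      biEval f x' (1 - ξ) = ξ ^ l * (Polynomial.aeval x (shiftCoeff f l) + ξ * u) := by
  have h1 := abs_sum_mul_pow_sub_le (T := 2 ^ ((s + 4) * N))
    (fun k => norm_aeval_shiftCoeff_le hf hn k (w := x) hx) hz hl hξ.le hξ1
  rw [← biEval_one_sub hf] at h1
  have h2 := abs_biEval_sub_le hf hn hx hx' (y := 1 - ξ) (by linarith) (by linarith)
  have h3 : |x - x'| ≤ ξ ^ (l + 1) :=
    hxx.trans (pow_le_pow_of_le_one hξ.le hξ1 (by omega))
  have hpos : 0 < ξ ^ (l + 1) := pow_pos hξ _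
  set b := Polynomial.aeval x (shiftCoeff f l)
  refine ⟨(biEval f x' (1 - ξ) - ξ ^ l * b) / ξ ^ (l + 1), ?_, ?_⟩
  · rw [abs_div, abs_of_pos hpos, div_le_iff₀ hpos]
    have h4 : ((N + 1 : ℕ) : ℝ) ≤ 2 ^ N := by exact_mod_cast Nat.lt_two_pow_self (n := N)
    rw [abs_sub_comm (biEval f x _)] at h2
    calc |biEval f x' (1 - ξ) - ξ ^ l * b|
        ≤ |biEval f x' (1 - ξ) - biEval f x (1 - ξ)| + |biEval f x (1 - ξ) - ξ ^ l * b| :=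
          abs_sub_le _ _ _
      _ ≤ 2 ^ ((s + 4) * N) * ξ ^ (l + 1) + N * 2 ^ ((s + 4) * N) * ξ ^ (l + 1) := by
          refine add_le_add (h2.trans ?_) h1
          gcongr
      _ = ((N + 1 : ℕ) : ℝ) * (2 ^ ((s + 4) * N) * ξ ^ (l + 1)) := by push_cast; ring
      _ ≤ 2 ^ N * (2 ^ ((s + 4) * N) * ξ ^ (l + 1)) := by gcongr
      _ = 2 ^ ((s + 5) * N) * ξ ^ (l + 1) := by
          rw [← mul_assoc, ← pow_add]
          congr 2
          ring
  · rw [pow_succ]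
    field_simp
    ring

theorem abs_div_sub_div_le {b d u v ξ E : ℝ} (hE : 1 ≤ E) (hb : |b| ≤ E) (hd : |d| ≤ E)
    (hd' : 1 ≤ |d| * E) (hu : |u| ≤ E) (hv : |v| ≤ E) (hξ : 0 < ξ) (hξE : ξ * (2 * E ^ 2) ≤ 1) :
    d + ξ * v ≠ 0 ∧ |b / d - (b + ξ * u) / (d + ξ * v)| ≤ 4 * E ^ 4 * ξ := by
  have hE0 : 0 < E := by linarith
  have h1 : 1 ≤ |d + ξ * v| * (2 * E) := by
    have h2 : |d| ≤ |d + ξ * v| + ξ * E := by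
      have h3 : |ξ * v| ≤ ξ * E := by
        rw [abs_mul, abs_of_pos hξ]
        gcongr
      have h4 := abs_sub (d + ξ * v) (ξ * v)
      rw [add_sub_cancel_right] at h4
      linarith
    nlinarith [mul_le_mul_of_nonneg_right h2 hE0.le]
  have hne : d + ξ * v ≠ 0 := by
    intro h
    rw [h, abs_zero, zero_mul] at h1
    linarith
  have hd0 : d ≠ 0 := by
    rintro rfl
    rw [abs_zero, zero_mul] at hd'
    linarith
  refine ⟨hne, ?_⟩
  have hnum : |b * (d + ξ * v) - d * (b + ξ * u)| ≤ ξ * (2 * E ^ 2) := by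
    have h5 : b * (d + ξ * v) - d * (b + ξ * u) = ξ * (b * v - d * u) := by ring
    rw [h5, abs_mul, abs_of_pos hξ]
    refine mul_le_mul_of_nonneg_left ?_ hξ.le
    calc |b * v - d * u| ≤ |b * v| + |d * u| := abs_sub _ _
      _ ≤ E * E + E * E := by
          rw [abs_mul, abs_mul]
          gcongr
      _ = 2 * E ^ 2 := by ring
  rw [div_sub_div _ _ hd0 hne, abs_div, abs_mul,
    div_le_iff₀ (mul_pos (abs_pos.mpr hd0) (abs_pos.mpr hne))]
  refine hnum.trans ?_
  have h6 : 1 ≤ (|d| * E) * (|d + ξ * v| * (2 * E)) := one_le_mul_of_one_le_of_one_le hd' h1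
  calc ξ * (2 * E ^ 2) ≤ ξ * (2 * E ^ 2) * ((|d| * E) * (|d + ξ * v| * (2 * E))) :=
        le_mul_of_one_le_right (by positivity) h6
    _ = 4 * E ^ 4 * ξ * (|d| * |d + ξ * v|) := by ring

/-- For every real algebraic number `α` there are positive integer constants
`C₁`, `C₂` such that for every integer `N ≥ 2` and all bivariate integer
polynomials `g`, `h` of total degree at most `N` with `‖g‖, ‖h‖ ≤ 2^N`, if
`L = lim_{z → 1⁻} g(α, z) / h(α, z)` exists (with `h(α, z) ≠ 0` for `z`
sufficiently close to 1 from below) then: (a) `|L - 2^{-C₁N²}| ≥ 2^{-C₁N²}`,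
and (b) for all `0 < ξ ≤ 2^{-C₂N²}` and all real `α̃` with
`|α - α̃| ≤ ξ^{2N+1}` we have `h(α̃, 1-ξ) ≠ 0` and
`|L - g(α̃, 1-ξ)/h(α̃, 1-ξ)| < 2^{-C₁N²}`. -/
theorem stmt14 (α : ℝ) (hα : IsAlgebraic ℤ α) :
    ∃ C₁ C₂ : ℕ, 0 < C₁ ∧ 0 < C₂ ∧ ∀ N : ℕ, 2 ≤ N →
      ∀ g h : MvPolynomial (Fin 2) ℤ,
      g.totalDegree ≤ N → h.totalDegree ≤ N →
      mvPolyNorm g ≤ 2 ^ N → mvPolyNorm h ≤ 2 ^ N →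
      ∀ L : ℝ,
        (∀ᶠ z in nhdsWithin 1 (Set.Iio 1), biEval h α z ≠ 0) →
        Tendsto (fun z : ℝ => biEval g α z / biEval h α z)
          (nhdsWithin 1 (Set.Iio 1)) (nhds L) →
        ((2 : ℝ) ^ (C₁ * N ^ 2))⁻¹ ≤ |L - ((2 : ℝ) ^ (C₁ * N ^ 2))⁻¹| ∧
        ∀ ξ : ℝ, 0 < ξ → ξ ≤ ((2 : ℝ) ^ (C₂ * N ^ 2))⁻¹ →
          ∀ α' : ℝ, |α - α'| ≤ ξ ^ (2 * N + 1) →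
            biEval h α' (1 - ξ) ≠ 0 ∧
            |L - biEval g α' (1 - ξ) / biEval h α' (1 - ξ)| <
              ((2 : ℝ) ^ (C₁ * N ^ 2))⁻¹ := by
  obtain ⟨s, t, d, hs, hLiou⟩ := exists_pow_le_abs_aeval α hα
  have hαs : |α| ≤ 2 ^ s := by linarith
  obtain ⟨e, he⟩ : ∃ e, e = (t + (s + 4)) * d + (s + 5) := ⟨_, rfl⟩
  refine ⟨2 * e + 1, (2 * e + 1) + (4 * e + 3), by omega, by omega,
    fun N hN g h hgd hhd hgn hhn L hne hL => ?_⟩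
  have hNN : N ≤ N ^ 2 := Nat.le_self_pow two_ne_zero N
  obtain ⟨E, hE⟩ : ∃ E : ℝ, E = 2 ^ (e * N) := ⟨_, rfl⟩
  have hE1 : 1 ≤ E := hE ▸ one_le_pow₀ one_le_two
  have hpowE : ∀ k, k ≤ e → (2 : ℝ) ^ (k * N) ≤ E := fun k hk =>
    hE ▸ pow_le_pow_right₀ one_le_two (Nat.mul_le_mul_right N hk)
  have hupper : ∀ f : MvPolynomial (Fin 2) ℤ, f.totalDegree ≤ N → mvPolyNorm f ≤ 2 ^ N →
      ∀ k, |Polynomial.aeval α (shiftCoeff f k)| ≤ E := fun f hfd hfn k =>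
    (norm_aeval_shiftCoeff_le hfd hfn k (w := α) hαs).trans (hpowE _ (by rw [he]; omega))
  have hlower : ∀ f : MvPolynomial (Fin 2) ℤ, f.totalDegree ≤ N → mvPolyNorm f ≤ 2 ^ N →
      ∀ k, Polynomial.aeval α (shiftCoeff f k) ≠ 0 →
        1 ≤ |Polynomial.aeval α (shiftCoeff f k)| * E := by
    intro f hfd hfn k hk
    refine (hLiou N (shiftCoeff f k) (2 ^ ((s + 4) * N)) (natDegree_shiftCoeff_le hfd k)
      (one_le_pow₀ one_le_two) (fun w hw => norm_aeval_shiftCoeff_le hfd hfn k hw) hk).trans ?_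
    refine mul_le_mul_of_nonneg_left ?_ (abs_nonneg _)
    rw [← pow_add, ← add_mul, ← pow_mul, mul_right_comm]
    exact hpowE _ (by rw [he]; omega)
  have hmap : Tendsto (fun ξ : ℝ => 1 - ξ) (nhdsWithin (0 : ℝ) (Set.Ioi 0))
      (nhdsWithin 1 (Set.Iio 1)) := by
    refine tendsto_nhdsWithin_iff.mpr ⟨?_, ?_⟩
    · have : Tendsto (fun ξ : ℝ => 1 - ξ) (nhds 0) (nhds (1 - 0)) :=
        (continuous_const.sub continuous_id).tendsto 0
      rw [sub_zero] at this
      exact this.mono_left nhdsWithin_le_nhds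
    · filter_upwards [self_mem_nhdsWithin] with ξ hξ
      exact sub_lt_self 1 (Set.mem_Ioi.mp hξ)
  have hexists : ∃ k, Polynomial.aeval α (shiftCoeff h k) ≠ 0 := by
    obtain ⟨ξ, hξ⟩ := (hmap.eventually hne).exists
    by_contra! hall
    exact hξ (by simp [biEval_one_sub hhd, hall])
  classical
  obtain ⟨l, hl0, hlmin⟩ : ∃ l, Polynomial.aeval α (shiftCoeff h l) ≠ 0 ∧
      ∀ k < l, Polynomial.aeval α (shiftCoeff h k) = 0 :=
    ⟨Nat.find hexists, Nat.find_spec hexists, fun k hk => not_not.mp (Nat.find_min hexists hk)⟩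
  have hlN : l ≤ N := by
    by_contra! hlt
    obtain ⟨ξ, hξ⟩ := (hmap.eventually hne).exists
    refine hξ ?_
    rw [biEval_one_sub hhd]
    refine Finset.sum_eq_zero fun k hk => ?_
    rw [Finset.mem_range] at hk
    rw [hlmin k (by omega), zero_mul]
  have hL' := hL.comp hmap
  simp only [Function.comp_def, biEval_one_sub hgd, biEval_one_sub hhd] at hL'
  obtain ⟨hgz, hgl⟩ := coeff_eq_of_tendsto_div (hupper g hgd hgn) (hupper h hhd hhn) hlmin hlN
    hl0 hL'
  have hLq : L = Polynomial.aeval α (shiftCoeff g l) / Polynomial.aeval α (shiftCoeff h l) := by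
    rw [hgl, mul_div_cancel_right₀ _ hl0]
  have hb := hupper g hgd hgn l
  have hd := hupper h hhd hhn l
  have hb' := hlower g hgd hgn l
  have hd' := hlower h hhd hhn l hl0
  set M : ℝ := 2 ^ ((2 * e + 1) * N ^ 2) with hM
  have hM0 : 0 < M := by positivity
  have hEM : 2 * E ^ 2 ≤ M := by
    rw [hE, hM, ← pow_mul, ← pow_succ']
    refine pow_le_pow_right₀ one_le_two ?_
    nlinarith
  constructor
  · rcases le_or_gt L 0 with hL0 | hL0
    · rw [abs_sub_comm]
      refine le_trans ?_ (le_abs_self _)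
      linarith
    · have hbne : Polynomial.aeval α (shiftCoeff g l) ≠ 0 := by
        rw [hgl]
        exact mul_ne_zero hL0.ne' hl0
      have h1 : 1 ≤ L * E ^ 2 := by
        have h2 := hb' hbne
        rw [hgl, abs_mul, abs_of_pos hL0] at h2
        calc 1 ≤ L * |Polynomial.aeval α (shiftCoeff h l)| * E := h2
          _ ≤ L * E * E := by gcongr
          _ = L * E ^ 2 := by ring
      have h3 : 2 * M⁻¹ ≤ L := by
        rw [← div_eq_mul_inv, div_le_iff₀ hM0]
        nlinarith
      refine le_trans ?_ (le_abs_self _)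
      linarith
  · intro ξ hξ hξC α' hαα'
    have hξM : 8 * E ^ 4 * M * ξ ≤ 1 := by
      have h1 : 8 * E ^ 4 * M ≤ 2 ^ ((2 * e + 1 + (4 * e + 3)) * N ^ 2) := by
        rw [add_mul _ _ (N ^ 2), pow_add, ← hM, mul_comm M]
        refine mul_le_mul_of_nonneg_right ?_ hM0.le
        rw [hE, show (8 : ℝ) = 2 ^ 3 by norm_num, ← pow_mul, ← pow_add]
        refine pow_le_pow_right₀ one_le_two ?_
        nlinarith
      calc 8 * E ^ 4 * M * ξ
          ≤ 2 ^ ((2 * e + 1 + (4 * e + 3)) * N ^ 2) *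
            (2 ^ ((2 * e + 1 + (4 * e + 3)) * N ^ 2))⁻¹ := by gcongr
        _ = 1 := mul_inv_cancel₀ (by positivity)
    have hM1 : 1 ≤ M := one_le_pow₀ one_le_two
    have hξE : ξ * (2 * E ^ 2) ≤ 1 := by
      refine le_trans ?_ hξM
      have h1 : 2 * E ^ 2 ≤ 8 * E ^ 4 * M :=
        calc 2 * E ^ 2 ≤ 8 * E ^ 4 :=
              mul_le_mul (by norm_num) (pow_le_pow_right₀ hE1 (by norm_num)) (by positivity)
                (by norm_num)
          _ ≤ 8 * E ^ 4 * M := le_mul_of_one_le_right (by positivity) hM1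
      rw [mul_comm]
      gcongr
    have hξ1 : ξ ≤ 1 := by nlinarith
    have hα's : |α'| ≤ 2 ^ s := by
      have h1 : |α - α'| ≤ 1 := hαα'.trans (pow_le_one₀ hξ.le hξ1)
      have h2 := abs_sub_abs_le_abs_sub α' α
      rw [abs_sub_comm] at h2
      linarith
    obtain ⟨u, hu, hgu⟩ := exists_biEval_eq_pow_mul hgd hgn hαs hα's hξ hξ1 hαα' hlN hgz
    obtain ⟨v, hv, hhv⟩ := exists_biEval_eq_pow_mul hhd hhn hαs hα's hξ hξ1 hαα' hlN hlmin
    have hsE := hpowE (s + 5) (by rw [he]; omega)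
    obtain ⟨hne', hdiff⟩ := abs_div_sub_div_le hE1 hb hd hd' (hu.trans hsE) (hv.trans hsE) hξ hξE
    have hpos : 0 < ξ ^ l := pow_pos hξ l
    refine ⟨by rw [hhv]; exact mul_ne_zero hpos.ne' hne', ?_⟩
    rw [hgu, hhv, mul_div_mul_left _ _ hpos.ne', hLq]
    refine hdiff.trans_lt ?_
    rw [← one_div, lt_div_iff₀ hM0]
    have : 0 < E ^ 4 * M * ξ := by positivity
    linarith
end
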